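/- Fix y = (y₁,y₂) ∈ ℝ² with y₂ > 0 and vectors g, ν ∈ ℝ². Define u^{T,W}ᵢ(x) = Σⱼ Σₖ Tᵢⱼₖ(x,y) νₖ gⱼ − Σⱼ Σₖ Tᵢⱼₖ(x,yᴵ) νᴵₖ gᴵⱼ − [x₂ ∂φᵀ/∂xᵢ(x) − δᵢ₂ φᵀ(x)], where φᵀ(x) = 2(νᴵ·gᴵ) Gᴰ[h](x,yᴵ) + 2 y₂ G^Q[νᴵ, gᴵ](x,yᴵ) with h = (0,1). Then u^{T,W} satisfies the no-slip condition: u^{T,W}ᵢ(x) = 0 for i = 1,2 and every x = (x₁,0) with x ≠ yᴵ. -/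

import Mathlib

open Real Finset

noncomputable section

/-- Points in two-dimensional Euclidean space. -/
abbrev E2 := EuclideanSpace ℝ (Fin 2)

/-- Partial derivative `∂f/∂xᵢ` of a scalar field on `ℝ²`. -/
def pd (i : Fin 2) (f : E2 → ℝ) (x : E2) : ℝ :=
  fderiv ℝ f x (EuclideanSpace.single i 1)

/-- Kronecker delta. -/
def kron (i j : Fin 2) : ℝ := if i = j then 1 else 0

/-- Reflected image point `yᴵ = (y₁, -y₂)`. -/
def reflPt (y : E2) : E2 := (EuclideanSpace.equiv (Fin 2) ℝ).symm ![y 0, -y 1]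

/-- Reflected vector `fᴵ = (f₁, -f₂)`. -/
def reflVec (f : Fin 2 → ℝ) : Fin 2 → ℝ := ![f 0, -f 1]

/-- Two-dimensional free-space Laplace Green's function `Gˢ(x,y) = -(1/2π) log|x-y|`. -/
def GS (x y : E2) : ℝ := -(1 / (2 * π)) * Real.log ‖x - y‖

/-- Two-dimensional dipole potential `Gᴰ[ν](x,y) = Σᵢ νᵢ ∂/∂yᵢ Gˢ(x,y)`. -/
def GD (ν : Fin 2 → ℝ) (x y : E2) : ℝ := ∑ i, ν i * pd i (fun z => GS x z) y

/-- Two-dimensional quadrupole potential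
`G^Q[ν,κ](x,y) = Σᵢ Σⱼ νᵢ κⱼ ∂²/∂yᵢ∂yⱼ Gˢ(x,y)`. -/
def GQ (ν κ : Fin 2 → ℝ) (x y : E2) : ℝ :=
  ∑ i, ∑ j, ν i * κ j * pd i (fun z => pd j (fun w => GS x w) z) y

/-- The two-dimensional stresslet
`Tᵢⱼₖ(x,y) = (1/π)(xᵢ-yᵢ)(xⱼ-yⱼ)(xₖ-yₖ)/|x-y|⁴`. -/
def stresslet2 (x y : E2) (i j k : Fin 2) : ℝ :=
  (1 / π) * (x i - y i) * (x j - y j) * (x k - y k) / ‖x - y‖ ^ 4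

/-- The two-dimensional Papkovich–Neuber potential for the stresslet image system:
`φᵀ(x) = 2(νᴵ·gᴵ) Gᴰ[h](x,yᴵ) + 2 y₂ G^Q[νᴵ,gᴵ](x,yᴵ)` with `h = (0,1)`. -/
def phiT2 (y : E2) (g ν : Fin 2 → ℝ) (x : E2) : ℝ :=
  2 * (∑ i, reflVec ν i * reflVec g i) * GD ![(0 : ℝ), 1] x (reflPt y)
    + 2 * y 1 * GQ (reflVec ν) (reflVec g) x (reflPt y)

/-- The half-plane stresslet velocity `u^{T,W}`. -/
def uTW2 (y : E2) (g ν : Fin 2 → ℝ) (i : Fin 2) (x : E2) : ℝ :=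
  (∑ j, ∑ k, stresslet2 x y i j k * ν k * g j)
    - (∑ j, ∑ k, stresslet2 x (reflPt y) i j k * reflVec ν k * reflVec g j)
    - (x 1 * pd i (phiT2 y g ν) x - if i = 1 then phiT2 y g ν x else 0)

lemma hasFDerivAt_norm_sub_sq (x z : E2) :
    HasFDerivAt (fun w : E2 => ‖x - w‖ ^ 2) (-(2 • innerSL ℝ (x - z))) z := by
  have h := ((hasFDerivAt_id z).const_sub x).norm_sq
  refine h.congr_fderiv ?_
  ext v
  simp
  ring

lemma inner_single_one (v : E2) (i : Fin 2) :
    inner ℝ v (EuclideanSpace.single i (1 : ℝ)) = v i := by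
  simp [EuclideanSpace.inner_single_right]

/-- The gradient of the Laplace Green's function in the source variable. -/
lemma pd_GS {x z : E2} (h : x ≠ z) (j : Fin 2) :
    pd j (fun w => GS x w) z = 1 / (2 * π) * ((x j - z j) / ‖x - z‖ ^ 2) := by
  have hn : ‖x - z‖ ^ 2 ≠ 0 := by simpa [sub_eq_zero] using h
  have hfun : (fun w => GS x w) = fun w => -(1 / (4 * π)) * Real.log (‖x - w‖ ^ 2) := by
    funext w
    rw [GS, Real.log_pow]
    push_cast
    ring
  rw [hfun, pd, (((hasFDerivAt_norm_sub_sq x z).log hn).const_mul _).fderiv]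
  simp only [smul_apply, neg_apply, innerSL_apply_apply, inner_single_one, PiLp.sub_apply,
    smul_eq_mul, nsmul_eq_mul]
  push_cast
  ring

/-- The Hessian of the Laplace Green's function in the source variable. -/
lemma pd_pd_GS {x z : E2} (h : x ≠ z) (i j : Fin 2) :
    pd i (fun w => pd j (fun v => GS x v) w) z =
      1 / (2 * π) * (2 * (x i - z i) * (x j - z j) / ‖x - z‖ ^ 4 - kron i j / ‖x - z‖ ^ 2) := by
  have hn : ‖x - z‖ ^ 2 ≠ 0 := by simpa [sub_eq_zero] using h
  have hn' : ‖x - z‖ ≠ 0 := by simpa [sub_eq_zero] using h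
  have hev : (fun w => pd j (fun v => GS x v) w) =ᶠ[nhds z]
      fun w => 1 / (2 * π) * ((x j - w j) * (‖x - w‖ ^ 2)⁻¹) := by
    filter_upwards [isOpen_ne.mem_nhds h.symm] with w hw
    rw [pd_GS (Ne.symm hw), div_eq_mul_inv (x j - w j)]
  have hc : HasFDerivAt (fun w : E2 => x j - w j) (-(EuclideanSpace.proj j : E2 →L[ℝ] ℝ)) z :=
    (EuclideanSpace.proj j : E2 →L[ℝ] ℝ).hasFDerivAt.const_sub (x j)
  have hinv := (hasDerivAt_inv hn).comp_hasFDerivAt z (hasFDerivAt_norm_sub_sq x z)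
  have hd : HasFDerivAt (fun w => 1 / (2 * π) * ((x j - w j) * (‖x - w‖ ^ 2)⁻¹)) _ z :=
    (hc.mul hinv).const_mul (1 / (2 * π))
  have hk : (EuclideanSpace.single i (1 : ℝ) : E2) j = kron i j := by
    simp [kron, eq_comm]
  rw [pd, hev.fderiv_eq, hd.fderiv]
  simp only [smul_apply, add_apply, neg_apply, innerSL_apply_apply, inner_single_one,
    PiLp.sub_apply, smul_eq_mul, nsmul_eq_mul, PiLp.proj_apply, hk, Function.comp_apply]
  push_cast
  field_simp
  ring

/-- the half-plane stresslet `u^{T,W}` satisfies the no-slip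
condition on the line `x₂ = 0`. -/
theorem stresslet_halfplane_no_slip (y : E2) (hy : 0 < y 1) (g ν : Fin 2 → ℝ) :
    ∀ x : E2, x 1 = 0 → x ≠ reflPt y → ∀ i, uTW2 y g ν i x = 0 := by
  intro x hx hne i
  have h0 : reflPt y 0 = y 0 := by simp [reflPt]
  have h1 : reflPt y 1 = -y 1 := by simp [reflPt]
  have hnorm : ‖x - y‖ = ‖x - reflPt y‖ := by
    simp [EuclideanSpace.norm_eq, Fin.sum_univ_two, h0, h1, hx]
  have hn : ‖x - reflPt y‖ ≠ 0 := by simpa [sub_eq_zero] using hne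
  fin_cases i <;>
    simp [uTW2, phiT2, GD, GQ, stresslet2, Fin.sum_univ_two, pd_GS hne, pd_pd_GS hne, hnorm, h0, h1,
      hx, reflVec, kron] <;> field_simp <;> ring
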